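/- Let Q be a Σ-quasimodel. The shift map σ : |Q⃗| → |Q⃗|, σ((w_n)_{n<ω}) = (w_{n+1})_{n<ω}, is continuous with respect to the topology T⃗_≺; in fact σ(N_{m+1}(w⃗)) ⊆ N_m(σ(w⃗)) for every realising path w⃗ and every m < ω. -/

import Mathlib

open scoped Classical

namespace Untangled

noncomputable section

/-- Formulas of the trimodal language `L`. -/
inductive Formula (PV : Type) : Type
  | var : PV → Formula PV
  | and : Formula PV → Formula PV → Formula PV
  | neg : Formula PV → Formula PV
  | dia : Formula PV → Formula PV
  | next : Formula PV → Formula PV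
  | ev : Formula PV → Formula PV
  deriving DecidableEq

namespace Formula

variable {PV : Type}

/-- Implication `φ → ψ := ¬(φ ∧ ¬ψ)`. -/
def impl (φ ψ : Formula PV) : Formula PV := .neg (.and φ (.neg ψ))

/-- Biconditional. -/
def fiff (φ ψ : Formula PV) : Formula PV := .and (impl φ ψ) (impl ψ φ)

/-- `□φ := ¬◇¬φ`. -/
def box (φ : Formula PV) : Formula PV := .neg (.dia (.neg φ))

/-- `■φ := ¬◆¬φ`. -/
def hence (φ : Formula PV) : Formula PV := .neg (.ev (.neg φ))

/-- The single negation of a formula: strip a leading negation if present,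
otherwise negate. -/
def sneg : Formula PV → Formula PV
  | .neg φ => φ
  | φ => .neg φ

end Formula

/-- A formula is a propositional tautology if it evaluates to `true` under
every Boolean valuation of formulas respecting `¬` and `∧`
(modal subformulas are treated as atoms). -/
def IsTautology {PV : Type} (φ : Formula PV) : Prop :=
  ∀ v : Formula PV → Bool,
    (∀ ψ : Formula PV, v ψ.neg = !v ψ) →
    (∀ ψ χ : Formula PV, v (ψ.and χ) = (v ψ && v χ)) →
    v φ = true

/-- The axiomatic system `DGL`. -/
inductive DGL {PV : Type} : Formula PV → Prop
  | taut {φ : Formula PV} : IsTautology φ → DGL φ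
  | axK (φ ψ : Formula PV) : DGL (((φ.impl ψ).box).impl ((φ.box).impl ψ.box))
  | axL (φ : Formula PV) : DGL ((((φ.box).impl φ).box).impl φ.box)
  | axNextNeg (φ : Formula PV) : DGL ((φ.next.neg).fiff (φ.neg.next))
  | axNextAnd (φ ψ : Formula PV) : DGL (((φ.and ψ).next).fiff ((φ.next).and (ψ.next)))
  | axC (φ : Formula PV) : DGL (((φ.next).and ((φ.box).next)).impl ((φ.next).box))
  | axKHence (φ ψ : Formula PV) : DGL (((φ.impl ψ).hence).impl ((φ.hence).impl (ψ.hence)))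
  | axFix (φ : Formula PV) : DGL ((φ.hence).impl (φ.and ((φ.hence).next)))
  | axInd (φ : Formula PV) : DGL (((φ.impl φ.next).hence).impl (φ.impl φ.hence))
  | mp {φ ψ : Formula PV} : DGL (φ.impl ψ) → DGL φ → DGL ψ
  | necBox {φ : Formula PV} : DGL φ → DGL φ.box
  | necNext {φ : Formula PV} : DGL φ → DGL φ.next
  | necHence {φ : Formula PV} : DGL φ → DGL φ.hence

/-- The Cantor derivative of a set: its set of limit points. -/
def cantorDeriv {X : Type*} [TopologicalSpace X] (A : Set X) : Set X :=
  {x | ∀ U : Set X, IsOpen U → x ∈ U → ∃ y, y ∈ U ∩ A ∧ y ≠ x}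

/-- A topological space is scattered if every subset contained in its own
Cantor derivative is empty. -/
def Scattered (X : Type*) [TopologicalSpace X] : Prop :=
  ∀ S : Set X, S ⊆ cantorDeriv S → S = ∅

/-- Truth sets in a dynamic topological model given by a (continuous) map `f`
and a valuation `ν`. -/
def truthSet {PV : Type} {X : Type*} [TopologicalSpace X] (f : X → X) (ν : PV → Set X) :
    Formula PV → Set X
  | .var p => ν p
  | .and φ ψ => truthSet f ν φ ∩ truthSet f ν ψ
  | .neg φ => (truthSet f ν φ)ᶜ
  | .dia φ => cantorDeriv (truthSet f ν φ)
  | .next φ => f ⁻¹' truthSet f ν φ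
  | .ev φ => ⋃ n : ℕ, (f^[n]) ⁻¹' truthSet f ν φ

/-- The downset topology of a (strict) order: open sets are the downward
closed sets. -/
def downsetTopology {X : Type*} (lt : X → X → Prop) : TopologicalSpace X where
  IsOpen U := ∀ x ∈ U, ∀ y, lt y x → y ∈ U
  isOpen_univ := fun _ _ y _ => Set.mem_univ y
  isOpen_inter := fun s t hs ht x hx y hy => ⟨hs x hx.1 y hy, ht x hx.2 y hy⟩
  isOpen_sUnion := fun S hS x hx y hy => by
    obtain ⟨t, htS, hxt⟩ := hx
    exact ⟨t, htS, hS t htS x hxt y hy⟩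
/-- `Σ ⋐ L`: `Γ` is closed under subformulas and single negations
(finiteness is expressed by `Γ : Finset _`). -/
structure GoodSigma {PV : Type} (Γ : Finset (Formula PV)) : Prop where
  and_cl : ∀ φ ψ : Formula PV, Formula.and φ ψ ∈ Γ → φ ∈ Γ ∧ ψ ∈ Γ
  neg_cl : ∀ φ : Formula PV, Formula.neg φ ∈ Γ → φ ∈ Γ
  dia_cl : ∀ φ : Formula PV, Formula.dia φ ∈ Γ → φ ∈ Γ
  next_cl : ∀ φ : Formula PV, Formula.next φ ∈ Γ → φ ∈ Γ
  ev_cl : ∀ φ : Formula PV, Formula.ev φ ∈ Γ → φ ∈ Γ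
  sneg_cl : ∀ φ ∈ Γ, Formula.sneg φ ∈ Γ

/-- `Φ` is a `Σ`-type over `Γ`. -/
structure IsType {PV : Type} (Γ : Finset (Formula PV)) (Φ : Finset (Formula PV)) : Prop where
  subset : Φ ⊆ Γ
  not_both : ∀ φ : Formula PV, ¬(φ ∈ Φ ∧ φ.neg ∈ Φ)
  dneg : ∀ φ : Formula PV, φ.neg.neg ∈ Φ → φ ∈ Φ
  and_mem : ∀ φ ψ : Formula PV, φ.and ψ ∈ Φ → φ ∈ Φ ∧ ψ ∈ Φ
  nand_mem : ∀ φ ψ : Formula PV, (φ.and ψ).neg ∈ Φ → φ.neg ∈ Φ ∨ ψ.neg ∈ Φ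
  hence_mem : ∀ φ : Formula PV, φ.hence ∈ Φ → φ ∈ Φ
  total : ∀ φ ∈ Γ, φ ∈ Φ ∨ Formula.sneg φ ∈ Φ

/-- A sensible pair of types. -/
structure SensiblePair {PV : Type} (Φ Ψ : Finset (Formula PV)) : Prop where
  next_mem : ∀ φ : Formula PV, φ.next ∈ Φ → φ ∈ Ψ
  next_neg : ∀ φ : Formula PV, φ.next.neg ∈ Φ → φ.neg ∈ Ψ
  ev_mem : ∀ φ : Formula PV, φ.ev ∈ Φ → φ ∈ Φ ∨ φ.ev ∈ Ψ
  hence_mem : ∀ φ : Formula PV, φ.hence ∈ Φ → φ.hence ∈ Ψ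

/-- The reflexive closure `≼` of a strict relation. -/
def Rle {W : Type*} (lt : W → W → Prop) (x y : W) : Prop := lt x y ∨ x = y

/-- `n`-fold composition of a relation. -/
def RelIter {W : Type*} (R : W → W → Prop) : ℕ → W → W → Prop
  | 0 => fun x y => x = y
  | n + 1 => fun x z => ∃ y, R x y ∧ RelIter R n y z

/-- A `Σ`-quasimodel: a locally finite `Σ`-labelled strict poset together with
an ω-sensible (serial, forward-confluent, sensible) transition relation. -/
structure Quasimodel (PV : Type) (Γ : Finset (Formula PV)) where
  good : GoodSigma Γ
  W : Type
  lt : W → W → Prop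
  lt_irrefl : ∀ w, ¬ lt w w
  lt_trans : ∀ u v w, lt u v → lt v w → lt u w
  locFin : ∀ w, Set.Finite {v | lt v w}
  label : W → Finset (Formula PV)
  label_type : ∀ w, IsType Γ (label w)
  label_dia : ∀ w (φ : Formula PV), φ.dia ∈ label w → ∃ v, lt v w ∧ φ ∈ label v
  label_box : ∀ w (φ : Formula PV), φ.box ∈ label w → ∀ v, lt v w → φ ∈ label v
  R : W → W → Prop
  R_fconf : ∀ w w' v, Rle lt w w' → R w v → ∃ v', R w' v' ∧ Rle lt v v'
  R_sens : ∀ w v, R w v → SensiblePair (label w) (label v)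
  R_serial : ∀ w, ∃ v, R w v
  R_omega : ∀ w (φ : Formula PV), φ.ev ∈ label w →
      ∃ n v, RelIter R n w v ∧ φ ∈ label v

variable {PV : Type} {Γ : Finset (Formula PV)}

/-- An infinite path in a quasimodel. -/
def IsPath (Q : Quasimodel PV Γ) (π : ℕ → Q.W) : Prop := ∀ n, Q.R (π n) (π (n + 1))

/-- A realising path in a quasimodel. -/
def IsRealising (Q : Quasimodel PV Γ) (π : ℕ → Q.W) : Prop :=
  IsPath Q π ∧ ∀ m (φ : Formula PV), φ.ev ∈ Q.label (π m) → ∃ k ≥ m, φ ∈ Q.label (π k)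

/-- The set (type) `|Q⃗|` of realising paths of `Q`. -/
def RPath (Q : Quasimodel PV Γ) : Type := {π : ℕ → Q.W // IsRealising Q π}

theorem isRealising_shift (Q : Quasimodel PV Γ) (π : ℕ → Q.W) (h : IsRealising Q π) :
    IsRealising Q (fun n => π (n + 1)) := by
  constructor
  · intro n
    exact h.1 (n + 1)
  · intro m φ hm
    obtain ⟨k, hk, hφ⟩ := h.2 (m + 1) φ hm
    refine ⟨k - 1, by omega, ?_⟩
    have hk1 : k - 1 + 1 = k := by omega
    simpa [hk1] using hφ

/-- The shift map `σ` on realising paths. -/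
def shift (Q : Quasimodel PV Γ) (π : RPath Q) : RPath Q :=
  ⟨fun n => π.1 (n + 1), isRealising_shift Q π.1 π.2⟩

/-- The basic `m`-neighbourhood `N_m(π)` of a realising path. -/
def Nbhd (Q : Quasimodel PV Γ) (π : RPath Q) (m : ℕ) : Set (RPath Q) :=
  {ρ | (∀ i < m, Rle Q.lt (ρ.1 i) (π.1 i)) ∧
       (∀ k < m, ρ.1 k = π.1 k → ∀ j ≥ k, ρ.1 j = π.1 j)}

/-- The topology `T⃗_≺` on `|Q⃗|`, generated by the `m`-neighbourhoods. -/
def limitTopology (Q : Quasimodel PV Γ) : TopologicalSpace (RPath Q) :=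
  TopologicalSpace.generateFrom {B | ∃ π m, B = Nbhd Q π m}

/-- The valuation of the limit model. -/
def limitVal (Q : Quasimodel PV Γ) (p : PV) : Set (RPath Q) :=
  {π | Formula.var p ∈ Q.label (π.1 0)}
/-- A `Σ`-state: a finite rooted `Σ`-labelled strict poset (carrier a finite
set of naturals). -/
structure SState (PV : Type) (Γ : Finset (Formula PV)) where
  carrier : Finset ℕ
  lt : ℕ → ℕ → Prop
  lt_irrefl : ∀ a, ¬ lt a a
  lt_trans : ∀ a b c, lt a b → lt b c → lt a c
  label : ℕ → Finset (Formula PV)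
  label_type : ∀ a ∈ carrier, IsType Γ (label a)
  label_dia : ∀ a ∈ carrier, ∀ φ : Formula PV, φ.dia ∈ label a →
      ∃ b ∈ carrier, lt b a ∧ φ ∈ label b
  label_box : ∀ a ∈ carrier, ∀ φ : Formula PV, φ.box ∈ label a →
      ∀ b ∈ carrier, lt b a → φ ∈ label b
  root : ℕ
  root_mem : root ∈ carrier
  root_top : ∀ a ∈ carrier, a ≠ root → lt a root

namespace SState

variable {PV : Type} {Γ : Finset (Formula PV)}

/-- The label `ℓ(w)` of the root of a state. -/
def topLabel (w : SState PV Γ) : Finset (Formula PV) := w.label w.root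

/-- The canonical substate of `w` rooted at `x ∈ |w|`. -/
def substateAt (w : SState PV Γ) (x : ℕ) (hx : x ∈ w.carrier) : SState PV Γ where
  carrier := w.carrier.filter (fun u => w.lt u x ∨ u = x)
  lt := w.lt
  lt_irrefl := w.lt_irrefl
  lt_trans := w.lt_trans
  label := w.label
  label_type := fun a ha => w.label_type a (Finset.mem_filter.mp ha).1
  label_dia := fun a ha φ hφ => by
    obtain ⟨ha1, ha2⟩ := Finset.mem_filter.mp ha
    obtain ⟨b, hb, hlt, hφb⟩ := w.label_dia a ha1 φ hφ
    refine ⟨b, Finset.mem_filter.mpr ⟨hb, ?_⟩, hlt, hφb⟩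
    rcases ha2 with h | h
    · exact Or.inl (w.lt_trans _ _ _ hlt h)
    · exact Or.inl (h ▸ hlt)
  label_box := fun a ha φ hφ b hb hlt =>
    w.label_box a (Finset.mem_filter.mp ha).1 φ hφ b (Finset.mem_filter.mp hb).1 hlt
  root := x
  root_mem := Finset.mem_filter.mpr ⟨hx, Or.inr rfl⟩
  root_top := fun a ha hne => by
    rcases (Finset.mem_filter.mp ha).2 with h | h
    · exact h
    · exact absurd h hne

theorem substateAt_card_lt (w : SState PV Γ) (x : ℕ) (hx : x ∈ w.carrier.erase w.root) :
    (w.substateAt x (Finset.mem_of_mem_erase hx)).carrier.card < w.carrier.card := by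
  apply Finset.card_lt_card
  rw [substateAt, Finset.filter_ssubset]
  refine ⟨w.root, w.root_mem, ?_⟩
  rintro (h | h)
  · exact w.lt_irrefl _ (w.lt_trans _ _ _ h
      (w.root_top x (Finset.mem_of_mem_erase hx) (Finset.ne_of_mem_erase hx)))
  · exact (Finset.ne_of_mem_erase hx) h.symm

end SState

/-- The verum formula `¬(p₀ ∧ ¬p₀)`. -/
def fTop (PV : Type) [Inhabited PV] : Formula PV :=
  Formula.neg (Formula.and (Formula.var default) (Formula.neg (Formula.var default)))

/-- The falsum formula `p₀ ∧ ¬p₀`. -/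
def fBot (PV : Type) [Inhabited PV] : Formula PV :=
  Formula.and (Formula.var default) (Formula.neg (Formula.var default))

/-- Finite conjunction of a list of formulas. -/
def bigAnd {PV : Type} [Inhabited PV] (l : List (Formula PV)) : Formula PV :=
  l.foldr Formula.and (fTop PV)

/-- Finite disjunction of a list of formulas (`φ ∨ ψ := ¬(¬φ ∧ ¬ψ)`). -/
def bigOr {PV : Type} [Inhabited PV] (l : List (Formula PV)) : Formula PV :=
  l.foldr (fun φ ψ => Formula.neg (Formula.and (Formula.neg φ) (Formula.neg ψ))) (fBot PV)

/-- The simulation formula `Sim(w) := ⋀ℓ_w(0_w) ∧ ⋀_{v ≺ w} ◇Sim(v)`. -/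
def Sim {PV : Type} [Inhabited PV] [DecidableEq PV] {Γ : Finset (Formula PV)}
    (w : SState PV Γ) : Formula PV :=
  Formula.and (bigAnd (w.label w.root).toList)
    (bigAnd (((w.carrier.erase w.root).attach.toList).map
      (fun x => Formula.dia (Sim (w.substateAt x.1 (Finset.mem_of_mem_erase x.2))))))
termination_by w.carrier.card
decreasing_by
  exact SState.substateAt_card_lt w x.1 x.2
/-- `Simulates w v` (`w ◁ v`): there is a labelled simulation `χ ⊆ |w| × |v|`
with `0_w χ 0_v` (label-preserving and strictly forward-confluent). -/
def Simulates {PV : Type} {Γ : Finset (Formula PV)} (w v : SState PV Γ) : Prop :=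
  ∃ χ : ℕ → ℕ → Prop,
    (∀ a b, χ a b → a ∈ w.carrier ∧ b ∈ v.carrier) ∧
    (∀ a b, χ a b → w.label a = v.label b) ∧
    (∀ a' a b, χ a b → w.lt a' a → a' ∈ w.carrier →
      ∃ b' ∈ v.carrier, v.lt b' b ∧ χ a' b') ∧
    χ w.root v.root

/-- `Substate v w` (`v ≺ w`): `v` is the generated substructure of `w` whose
domain is `{u : u ≼_w 0_v}`, for some non-root `0_v ∈ |w|`. -/
def Substate {PV : Type} {Γ : Finset (Formula PV)} (v w : SState PV Γ) : Prop :=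
  v.root ∈ w.carrier ∧ v.root ≠ w.root ∧
  v.carrier = w.carrier.filter (fun u => w.lt u v.root ∨ u = v.root) ∧
  (∀ a ∈ v.carrier, ∀ b ∈ v.carrier, (v.lt a b ↔ w.lt a b)) ∧
  (∀ a ∈ v.carrier, v.label a = w.label a)

/-- `hgt(w)`: the maximal length of a `≺`-chain in `|w|`. -/
def hgt {PV : Type} {Γ : Finset (Formula PV)} (w : SState PV Γ) : ℕ :=
  sSup {n | ∃ c : ℕ → ℕ, (∀ i < n, c i ∈ w.carrier) ∧
    ∀ i j, i < j → j < n → w.lt (c i) (c j)}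

/-- `y` is a daughter of `x` in `w`: an immediate `≺`-predecessor. -/
def IsDaughter {PV : Type} {Γ : Finset (Formula PV)} (w : SState PV Γ) (y x : ℕ) : Prop :=
  y ∈ w.carrier ∧ w.lt y x ∧ ¬ ∃ z ∈ w.carrier, w.lt y z ∧ w.lt z x

/-- `wdt(w)`: the maximal number of pairwise `≺`-incomparable daughters of a
point of `w`. -/
def wdt {PV : Type} {Γ : Finset (Formula PV)} (w : SState PV Γ) : ℕ :=
  sSup {n | ∃ x ∈ w.carrier, ∃ D : Finset ℕ, D.card = n ∧
    (∀ y ∈ D, IsDaughter w y x) ∧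
    ∀ y ∈ D, ∀ z ∈ D, y ≠ z → ¬ w.lt y z ∧ ¬ w.lt z y}

/-- The norm `‖w‖ = max(hgt(w), wdt(w))` of a state. -/
def snorm {PV : Type} {Γ : Finset (Formula PV)} (w : SState PV Γ) : ℕ :=
  max (hgt w) (wdt w)

/-- `MapsTo w v` (`w ↦ v`): there is a sensible (forward-confluent,
label-sensible) relation `R ⊆ |w| × |v|` with `0_w R 0_v`. -/
def MapsTo {PV : Type} {Γ : Finset (Formula PV)} (w v : SState PV Γ) : Prop :=
  ∃ R : ℕ → ℕ → Prop,
    (∀ a b, R a b → a ∈ w.carrier ∧ b ∈ v.carrier) ∧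
    (∀ a b, R a b → SensiblePair (w.label a) (v.label b)) ∧
    (∀ a a' b, R a b → Rle w.lt a a' → a' ∈ w.carrier → ∃ b', R a' b' ∧ Rle v.lt b b') ∧
    R w.root v.root

/-- The set `{◇φ : ◇φ ∈ ℓ_w(u) for some u ∈ |w|}`. -/
def diaSet {PV : Type} [DecidableEq PV] {Γ : Finset (Formula PV)} (w : SState PV Γ) :
    Finset (Formula PV) :=
  w.carrier.biUnion fun u => (w.label u).filter fun φ => ∃ ψ : Formula PV, φ = Formula.dia ψ

/-- `BFuture w v` (`w ⇝ v`): `v` is a bounded future of `w`. -/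
def BFuture {PV : Type} [DecidableEq PV] {Γ : Finset (Formula PV)} (w v : SState PV Γ) : Prop :=
  MapsTo w v ∧ snorm v ≤ snorm w + (diaSet w).card

/-- A state is consistent if the negation of its simulation formula is not
derivable in `DGL`. -/
def Consistent {PV : Type} [Inhabited PV] [DecidableEq PV] {Γ : Finset (Formula PV)}
    (w : SState PV Γ) : Prop :=
  ¬ DGL (Formula.neg (Sim w))

/-- Isomorphism of `Σ`-states (as rooted labelled posets). -/
def SIso {PV : Type} {Γ : Finset (Formula PV)} (w v : SState PV Γ) : Prop :=
  ∃ g : ℕ → ℕ,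
    Set.BijOn g ↑w.carrier ↑v.carrier ∧ g w.root = v.root ∧
    (∀ a ∈ w.carrier, ∀ b ∈ w.carrier, (w.lt a b ↔ v.lt (g a) (g b))) ∧
    (∀ a ∈ w.carrier, w.label a = v.label (g a))

/-- An efficient path of `Σ`-states: consecutive states are bounded futures
and no earlier state simulates a later one. -/
def EfficientPath {PV : Type} [DecidableEq PV] {Γ : Finset (Formula PV)}
    (l : List (SState PV Γ)) : Prop :=
  l.Chain' BFuture ∧
  ∀ (i j : ℕ) (hi : i < l.length) (hj : j < l.length), i < j →
    ¬ Simulates (l.get ⟨i, hi⟩) (l.get ⟨j, hj⟩)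

/-- `v ∈ ρ(w)`: `v` is efficiently reachable from `w`, i.e. some efficient
path of consistent states leads from `w` to `v`. -/
def EffReachable {PV : Type} [Inhabited PV] [DecidableEq PV] {Γ : Finset (Formula PV)}
    (w v : SState PV Γ) : Prop :=
  ∃ l : List (SState PV Γ), EfficientPath l ∧ (∀ u ∈ l, Consistent u) ∧
    l.head? = some w ∧ l.getLast? = some v

theorem Rle.trans {Q : Quasimodel PV Γ} {u v w : Q.W} (huv : Rle Q.lt u v)
    (hvw : Rle Q.lt v w) : Rle Q.lt u w := by
  rcases huv with huv | rfl
  · rcases hvw with hvw | rfl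
    · exact Or.inl (Q.lt_trans _ _ _ huv hvw)
    · exact Or.inl huv
  · exact hvw

theorem Rle.antisymm {Q : Quasimodel PV Γ} {u v : Q.W} (huv : Rle Q.lt u v)
    (hvu : Rle Q.lt v u) : u = v := by
  rcases huv with huv | rfl
  · rcases hvu with hvu | rfl
    · exact absurd (Q.lt_trans _ _ _ huv hvu) (Q.lt_irrefl _)
    · rfl
  · rfl

theorem mem_Nbhd_self (Q : Quasimodel PV Γ) (π : RPath Q) (m : ℕ) : π ∈ Nbhd Q π m :=
  ⟨fun _ _ => Or.inr rfl, fun _ _ _ _ _ => rfl⟩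

/-- A basic neighbourhood contains the basic neighbourhood, at the same level, of each of
its points. -/
theorem Nbhd_subset_of_mem (Q : Quasimodel PV Γ) {π ρ : RPath Q} {m : ℕ}
    (hρ : ρ ∈ Nbhd Q π m) : Nbhd Q ρ m ⊆ Nbhd Q π m := by
  intro τ hτ
  refine ⟨fun i hi => (hτ.1 i hi).trans (hρ.1 i hi), fun k hk hτπ j hj => ?_⟩
  have hρτ : τ.1 k = ρ.1 k := (hτ.1 k hk).antisymm (hτπ ▸ hρ.1 k hk)
  exact (hτ.2 k hk hρτ j hj).trans (hρ.2 k hk (hρτ.symm.trans hτπ) j hj)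

theorem shift_mem_Nbhd (Q : Quasimodel PV Γ) {π ρ : RPath Q} {m : ℕ}
    (hρ : ρ ∈ Nbhd Q π (m + 1)) : shift Q ρ ∈ Nbhd Q (shift Q π) m :=
  ⟨fun i hi => hρ.1 (i + 1) (by omega),
    fun k hk h j hj => hρ.2 (k + 1) (by omega) h (j + 1) (by omega)⟩

/-- the shift map is continuous with respect to `T⃗_≺`; in fact
`σ(N_{m+1}(w⃗)) ⊆ N_m(σ(w⃗))`. -/
theorem shift_continuous {PV : Type} {Γ : Finset (Formula PV)} (Q : Quasimodel PV Γ) :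
    @Continuous (RPath Q) (RPath Q) (limitTopology Q) (limitTopology Q) (shift Q) ∧
    ∀ (π : RPath Q) (m : ℕ), shift Q '' Nbhd Q π (m + 1) ⊆ Nbhd Q (shift Q π) m := by
  refine ⟨?_, ?_⟩
  · let _ : TopologicalSpace (RPath Q) := limitTopology Q
    refine continuous_generateFrom_iff.mpr ?_
    rintro _ ⟨π, m, rfl⟩
    refine isOpen_iff_forall_mem_open.mpr fun ρ hρ => ⟨Nbhd Q ρ (m + 1), fun τ hτ =>
      Nbhd_subset_of_mem Q hρ (shift_mem_Nbhd Q hτ),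
      TopologicalSpace.isOpen_generateFrom_of_mem ⟨ρ, m + 1, rfl⟩, mem_Nbhd_self Q ρ (m + 1)⟩
  · rintro π m _ ⟨ρ, hρ, rfl⟩
    exact shift_mem_Nbhd Q hρ

end

end Untangled
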